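/- arXiv:2507.05533 — 2 statements merged into one kernel-verified Lean document; each statement's English description precedes it below -/
import Mathlib

section
/- Let X ∈ ℝ^{d×N} be a matrix each of whose columns has Euclidean norm at most 1, W ∈ ℝ^{m×d}, C ∈ ℝ^{k×m}, V ∈ ℝ^{m×k}, and let A¹, A², A* ∈ ℝ^{N×N} with n-th columns a²ₙ of A² and a*ₙ of A*. Then ‖C σ(V C σ(W X A¹) a²ₙ) − C σ(V C σ(W X A*) a*ₙ)‖₂ ≤ ‖C‖₂² ‖V‖₂ ‖W‖₂ · ( (‖A*‖₁ + ‖A¹ − A*‖₁) ‖A² − A*‖₁ + ‖A¹ − A*‖₁ ‖A*‖₁ ). -/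
open scoped BigOperators

/-- Euclidean (ℓ2) norm of a finite real vector. -/
noncomputable def l2norm {n : ℕ} (v : Fin n → ℝ) : ℝ := Real.sqrt (∑ i, (v i) ^ 2)

/-- Maximum absolute column sum of a matrix (the ℓ1-induced operator norm). -/
noncomputable def colNorm {m n : ℕ} (M : Matrix (Fin m) (Fin n) ℝ) : ℝ :=
  ⨆ j, ∑ i, |M i j|

/-- Spectral norm (ℓ2-induced operator norm) of a matrix. -/
noncomputable def specNorm {m n : ℕ} (M : Matrix (Fin m) (Fin n) ℝ) : ℝ :=
  ⨆ v : {v : Fin n → ℝ // l2norm v ≤ 1}, l2norm (M.mulVec v.1)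

/-- Entrywise ReLU on vectors. -/
def reluV {n : ℕ} (v : Fin n → ℝ) : Fin n → ℝ := fun i => max (v i) 0

/-- Entrywise ReLU on matrices. -/
def reluM {m n : ℕ} (M : Matrix (Fin m) (Fin n) ℝ) : Matrix (Fin m) (Fin n) ℝ :=
  Matrix.of fun i j => max (M i j) 0

theorem l2norm_eq_norm_toLp {n : ℕ} (v : Fin n → ℝ) : l2norm v = ‖WithLp.toLp 2 v‖ := by
  simp [l2norm, EuclideanSpace.norm_eq]

theorem l2norm_nonneg {n : ℕ} (v : Fin n → ℝ) : 0 ≤ l2norm v := Real.sqrt_nonneg _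

theorem l2norm_add_le {n : ℕ} (v w : Fin n → ℝ) : l2norm (v + w) ≤ l2norm v + l2norm w := by
  simpa [l2norm_eq_norm_toLp] using norm_add_le (WithLp.toLp 2 v) (WithLp.toLp 2 w)

theorem l2norm_smul {n : ℕ} (c : ℝ) (v : Fin n → ℝ) : l2norm (c • v) = |c| * l2norm v := by
  simp [l2norm_eq_norm_toLp, norm_smul]

theorem l2norm_sum_le {n : ℕ} {ι : Type*} (s : Finset ι) (f : ι → Fin n → ℝ) :
    l2norm (∑ i ∈ s, f i) ≤ ∑ i ∈ s, l2norm (f i) := by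
  simpa [l2norm_eq_norm_toLp, WithLp.toLp_sum] using norm_sum_le s fun i => WithLp.toLp 2 (f i)

theorem l2norm_mono {n : ℕ} {v w : Fin n → ℝ} (h : ∀ i, |v i| ≤ |w i|) :
    l2norm v ≤ l2norm w :=
  Real.sqrt_le_sqrt (Finset.sum_le_sum fun i _ => sq_le_sq.mpr (h i))

theorem l2norm_reluV_le {n : ℕ} (v : Fin n → ℝ) : l2norm (reluV v) ≤ l2norm v :=
  l2norm_mono fun i => by simpa [reluV] using abs_max_sub_max_le_abs (v i) 0 0

theorem l2norm_reluV_sub_le {n : ℕ} (v w : Fin n → ℝ) :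
    l2norm (reluV v - reluV w) ≤ l2norm (v - w) :=
  l2norm_mono fun i => abs_max_sub_max_le_abs (v i) (w i) 0

theorem mulVec_eq_sum_smul_col {m n : ℕ} (M : Matrix (Fin m) (Fin n) ℝ) (v : Fin n → ℝ) :
    M.mulVec v = ∑ j, v j • M.col j := by
  ext i
  simp [Matrix.mulVec, dotProduct, mul_comm]

theorem bddAbove_specNorm {m n : ℕ} (M : Matrix (Fin m) (Fin n) ℝ) :
    BddAbove (Set.range fun v : {v : Fin n → ℝ // l2norm v ≤ 1} => l2norm (M.mulVec v.1)) := by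
  refine ⟨∑ j, l2norm (M.col j), ?_⟩
  rintro _ ⟨⟨v, hv⟩, rfl⟩
  have hcoord (j : Fin n) : |v j| ≤ 1 := by
    rw [l2norm_eq_norm_toLp] at hv
    exact (PiLp.norm_apply_le (WithLp.toLp 2 v) j).trans hv
  change l2norm (M.mulVec v) ≤ _
  rw [mulVec_eq_sum_smul_col]
  refine (l2norm_sum_le _ _).trans (Finset.sum_le_sum fun j _ => ?_)
  rw [l2norm_smul]
  exact mul_le_of_le_one_left (l2norm_nonneg _) (hcoord j)

theorem specNorm_nonneg {m n : ℕ} (M : Matrix (Fin m) (Fin n) ℝ) : 0 ≤ specNorm M :=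
  Real.iSup_nonneg fun _ => l2norm_nonneg _

theorem l2norm_mulVec_le {m n : ℕ} (M : Matrix (Fin m) (Fin n) ℝ) (v : Fin n → ℝ) :
    l2norm (M.mulVec v) ≤ specNorm M * l2norm v := by
  rcases (l2norm_nonneg v).eq_or_lt with h | h
  · have hv : v = 0 := by
      rw [l2norm_eq_norm_toLp, eq_comm, norm_eq_zero] at h
      simpa using h
    simp [hv, l2norm]
  · have hunit : l2norm ((l2norm v)⁻¹ • v) ≤ 1 := by
      rw [l2norm_smul, abs_of_pos (inv_pos.mpr h), inv_mul_cancel₀ h.ne']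
    have hle : l2norm (M.mulVec ((l2norm v)⁻¹ • v)) ≤ specNorm M :=
      le_ciSup (bddAbove_specNorm M) ⟨_, hunit⟩
    rwa [Matrix.mulVec_smul, l2norm_smul, abs_of_pos (inv_pos.mpr h), inv_mul_le_iff₀ h,
      mul_comm] at hle

theorem sum_abs_le_colNorm {m n : ℕ} (M : Matrix (Fin m) (Fin n) ℝ) (j : Fin n) :
    ∑ i, |M i j| ≤ colNorm M :=
  le_ciSup (f := fun j => ∑ i, |M i j|) (Set.finite_range _).bddAbove j

theorem colNorm_nonneg {m n : ℕ} (M : Matrix (Fin m) (Fin n) ℝ) : 0 ≤ colNorm M :=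
  Real.iSup_nonneg fun _ => Finset.sum_nonneg fun _ _ => abs_nonneg _

theorem colNorm_le_add_colNorm_sub {m n : ℕ} (A B : Matrix (Fin m) (Fin n) ℝ) :
    colNorm A ≤ colNorm B + colNorm (A - B) := by
  refine Real.iSup_le (fun j => ?_) (add_nonneg (colNorm_nonneg _) (colNorm_nonneg _))
  refine le_trans ?_ (add_le_add (sum_abs_le_colNorm B j) (sum_abs_le_colNorm (A - B) j))
  rw [← Finset.sum_add_distrib]
  refine Finset.sum_le_sum fun i _ => ?_
  simpa using abs_add_le (B i j) (A i j - B i j)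

/-- A matrix whose columns have Euclidean norm at most `c` maps `ℓ1` to `ℓ2` with norm at
most `c`. -/
theorem l2norm_mulVec_le_of_col_le {m n : ℕ} {M : Matrix (Fin m) (Fin n) ℝ} {c : ℝ}
    (hM : ∀ j, l2norm (M.col j) ≤ c) (v : Fin n → ℝ) :
    l2norm (M.mulVec v) ≤ c * ∑ j, |v j| := by
  rw [mulVec_eq_sum_smul_col, Finset.mul_sum]
  refine (l2norm_sum_le _ _).trans (Finset.sum_le_sum fun j _ => ?_)
  rw [l2norm_smul, mul_comm]
  exact mul_le_mul_of_nonneg_right (hM j) (abs_nonneg _)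

theorem l2norm_col_mul_mul_le {d m n p : ℕ} (W : Matrix (Fin m) (Fin d) ℝ)
    {X : Matrix (Fin d) (Fin n) ℝ} (hX : ∀ j, l2norm (X.col j) ≤ 1)
    (A : Matrix (Fin n) (Fin p) ℝ) (j : Fin p) :
    l2norm ((W * X * A).col j) ≤ specNorm W * colNorm A := by
  have hcol : (W * X * A).col j = W.mulVec (X.mulVec (A.col j)) := by
    rw [Matrix.mulVec_mulVec]
    rfl
  rw [hcol]
  refine (l2norm_mulVec_le _ _).trans (mul_le_mul_of_nonneg_left ?_ (specNorm_nonneg W))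
  exact ((l2norm_mulVec_le_of_col_le hX _).trans_eq (one_mul _)).trans (sum_abs_le_colNorm A j)

theorem stmt_2 {d N m k : ℕ} (X : Matrix (Fin d) (Fin N) ℝ)
    (hX : ∀ j : Fin N, l2norm (fun i => X i j) ≤ 1)
    (W : Matrix (Fin m) (Fin d) ℝ) (C : Matrix (Fin k) (Fin m) ℝ)
    (V : Matrix (Fin m) (Fin k) ℝ)
    (A1 A2 Astar : Matrix (Fin N) (Fin N) ℝ) (n : Fin N) :
    l2norm
      (C.mulVec (reluV (V.mulVec ((C * reluM (W * X * A1)).mulVec (fun i => A2 i n)))) -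
       C.mulVec (reluV (V.mulVec ((C * reluM (W * X * Astar)).mulVec (fun i => Astar i n))))) ≤
      specNorm C ^ 2 * specNorm V * specNorm W *
        ((colNorm Astar + colNorm (A1 - Astar)) * colNorm (A2 - Astar) +
          colNorm (A1 - Astar) * colNorm Astar) := by
  set S₁ := reluM (W * X * A1)
  set S := reluM (W * X * Astar)
  set a₂ : Fin N → ℝ := fun i => A2 i n
  set a : Fin N → ℝ := fun i => Astar i n
  have hS₁ (j : Fin N) :
      l2norm (S₁.col j) ≤ specNorm W * (colNorm Astar + colNorm (A1 - Astar)) :=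
    (l2norm_reluV_le _).trans <| (l2norm_col_mul_mul_le W hX A1 j).trans <|
      mul_le_mul_of_nonneg_left (colNorm_le_add_colNorm_sub A1 Astar) (specNorm_nonneg W)
  have hS (j : Fin N) : l2norm ((S₁ - S).col j) ≤ specNorm W * colNorm (A1 - Astar) := by
    refine (l2norm_reluV_sub_le ((W * X * A1).col j) ((W * X * Astar).col j)).trans ?_
    have h := l2norm_col_mul_mul_le W hX (A1 - Astar) j
    rwa [Matrix.mul_sub] at h
  have hsplit : S₁.mulVec a₂ - S.mulVec a = S₁.mulVec (a₂ - a) + (S₁ - S).mulVec a := by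
    rw [Matrix.mulVec_sub, Matrix.sub_mulVec]
    abel
  have hu : l2norm (S₁.mulVec a₂ - S.mulVec a) ≤
      specNorm W * (colNorm Astar + colNorm (A1 - Astar)) * colNorm (A2 - Astar) +
        specNorm W * colNorm (A1 - Astar) * colNorm Astar := by
    rw [hsplit]
    refine (l2norm_add_le _ _).trans (add_le_add ?_ ?_)
    · refine (l2norm_mulVec_le_of_col_le hS₁ _).trans
        (mul_le_mul_of_nonneg_left (sum_abs_le_colNorm (A2 - Astar) n) ?_)
      exact mul_nonneg (specNorm_nonneg _) (add_nonneg (colNorm_nonneg _) (colNorm_nonneg _))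
    · refine (l2norm_mulVec_le_of_col_le hS _).trans
        (mul_le_mul_of_nonneg_left (sum_abs_le_colNorm Astar n) ?_)
      exact mul_nonneg (specNorm_nonneg _) (colNorm_nonneg _)
  have hC := specNorm_nonneg C
  have hV := specNorm_nonneg V
  rw [← Matrix.mulVec_sub, ← Matrix.mulVec_mulVec, ← Matrix.mulVec_mulVec]
  calc
    _ ≤ specNorm C * l2norm (V.mulVec (C.mulVec (S₁.mulVec a₂)) -
          V.mulVec (C.mulVec (S.mulVec a))) :=
      (l2norm_mulVec_le _ _).trans (mul_le_mul_of_nonneg_left (l2norm_reluV_sub_le _ _) hC)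
    _ ≤ specNorm C * (specNorm V * (specNorm C * l2norm (S₁.mulVec a₂ - S.mulVec a))) := by
      rw [← Matrix.mulVec_sub, ← Matrix.mulVec_sub]
      refine mul_le_mul_of_nonneg_left ((l2norm_mulVec_le _ _).trans ?_) hC
      exact mul_le_mul_of_nonneg_left (l2norm_mulVec_le _ _) hV
    _ ≤ specNorm C * (specNorm V * (specNorm C *
          (specNorm W * (colNorm Astar + colNorm (A1 - Astar)) * colNorm (A2 - Astar) +
            specNorm W * colNorm (A1 - Astar) * colNorm Astar))) := by
      gcongr
    _ = _ := by ring
end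

section
/- For every real δ with 0 ≤ δ ≤ 1, e^δ / (1 + δ)^{1+δ} ≤ exp( − δ²/3 ). -/
theorem stmt_7 :
    ∀ δ : ℝ, 0 ≤ δ → δ ≤ 1 →
      Real.exp δ / (1 + δ) ^ (1 + δ) ≤ Real.exp (-(δ ^ 2) / 3) := by
  intro δ h0 h1
  have hpos : 0 < 1 + δ := by linarith
  have hlog : δ + δ ^ 2 / 3 ≤ Real.log (1 + δ) * (1 + δ) := by
    calc δ + δ ^ 2 / 3 ≤ 2 * δ / (δ + 2) * (1 + δ) := by
          rw [div_mul_eq_mul_div, le_div_iff₀ (by linarith)]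
          nlinarith [mul_nonneg (mul_nonneg h0 h0) (sub_nonneg.2 h1)]
      _ ≤ Real.log (1 + δ) * (1 + δ) :=
          mul_le_mul_of_nonneg_right (Real.le_log_one_add_of_nonneg h0) hpos.le
  rw [Real.rpow_def_of_pos hpos, ← Real.exp_sub, Real.exp_le_exp]
  linarith
end
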